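/- Let 1 < q < 3, β > 0 and ξ ∈ ℝ. Set q₁ = (1+q)/(3−q), β₊ = (3−q)/(8 β^{2−q} C_q^{2(q−1)}), B = (2−q)/(4 β^{2−q} C_q^{2(q−1)}), and define V(t) := e_{q₁}^{−β₊ ξ² t^{2(2−q)/(3−q)}} for t > 0. Then V is positive and differentiable on (0,∞) and satisfies the nonlinear ordinary differential equation V'(t) = −B · ξ² · t^{−(q−1)/(3−q)} · V(t)^{q₁} for all t > 0; moreover, if in addition q < 2, then V(t) → 1 as t → 0⁺. -/

import Mathlib

open MeasureTheory Complex Real Set Filter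

noncomputable section

/-- The complex `q`-exponential: principal branch of `(1+(1-q)z)^{1/(1-q)}`,
set to `0` when `1+(1-q)z` is a nonpositive real; `exp z` for `q = 1`. -/
def qExp (q : ℝ) (z : ℂ) : ℂ :=
  if q = 1 then Complex.exp z
  else if (1 + (1 - q) * z).im = 0 ∧ (1 + (1 - q) * z).re ≤ 0 then 0
  else (1 + (1 - q) * z) ^ ((1 : ℂ) / (1 - q))

/-- The real `q`-exponential: `(1+(1-q)z)^{1/(1-q)}` when `1+(1-q)z > 0`,
`0` when `1+(1-q)z ≤ 0`; `exp z` for `q = 1`. -/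
def qExpR (q z : ℝ) : ℝ :=
  if q = 1 then Real.exp z
  else if 1 + (1 - q) * z ≤ 0 then 0
  else (1 + (1 - q) * z) ^ ((1 : ℝ) / (1 - q))

/-- The normalizing constant `C_q = ∫_ℝ e_q^{-x²} dx`. -/
def Cq (q : ℝ) : ℝ := ∫ x : ℝ, qExpR q (-x ^ 2)

theorem qExpR_of_pos {q z : ℝ} (hq : q ≠ 1) (hz : 0 < 1 + (1 - q) * z) :
    qExpR q z = (1 + (1 - q) * z) ^ ((1 : ℝ) / (1 - q)) := by
  rw [qExpR, if_neg hq, if_neg hz.not_ge]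

theorem qExpR_pos {q z : ℝ} (hq : q ≠ 1) (hz : 0 < 1 + (1 - q) * z) : 0 < qExpR q z := by
  rw [qExpR_of_pos hq hz]
  exact Real.rpow_pos_of_pos hz _

theorem qExpR_zero (q : ℝ) : qExpR q 0 = 1 := by
  simp [qExpR]

/-- The `q`-exponential solves `y' = y ^ q` on the interior of its support. -/
theorem hasDerivAt_qExpR {q z : ℝ} (hq : q ≠ 1) (hz : 0 < 1 + (1 - q) * z) :
    HasDerivAt (qExpR q) (qExpR q z ^ q) z := by
  have hq' : 1 - q ≠ 0 := sub_ne_zero.mpr hq.symm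
  have hbase : HasDerivAt (fun y : ℝ => 1 + (1 - q) * y) (1 - q) z := by
    simpa using ((hasDerivAt_id z).const_mul (1 - q)).const_add 1
  have hpow := hbase.rpow_const (p := (1 : ℝ) / (1 - q)) (Or.inl hz.ne')
  have heq : qExpR q =ᶠ[nhds z] fun y => (1 + (1 - q) * y) ^ ((1 : ℝ) / (1 - q)) := by
    filter_upwards [hbase.continuousAt.eventually (lt_mem_nhds hz)] with y hy
    exact qExpR_of_pos hq hy
  refine (hpow.congr_of_eventuallyEq heq).congr_deriv ?_
  rw [qExpR_of_pos hq hz, ← Real.rpow_mul hz.le, mul_one_div_cancel hq', one_mul]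
  congr 1
  field_simp
  ring

theorem qExpR_nonneg (q z : ℝ) : 0 ≤ qExpR q z := by
  unfold qExpR
  split_ifs with h₁ h₂
  · exact (Real.exp_pos z).le
  · exact le_rfl
  · exact Real.rpow_nonneg (not_le.mp h₂).le _

theorem Cq_nonneg (q : ℝ) : 0 ≤ Cq q :=
  integral_nonneg fun _ => qExpR_nonneg q _

/-- `V(t) = e_{q₁}^{-β₊ ξ² t^{2(2-q)/(3-q)}}` is positive and
differentiable on `(0,∞)`, satisfies `V' = -B ξ² t^{-(q-1)/(3-q)} V^{q₁}` there,
and (if moreover `q < 2`) tends to `1` as `t → 0⁺`. -/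
theorem ode_solution_porous_medium (q β ξ : ℝ) (hq1 : 1 < q) (hq3 : q < 3) (hβ : 0 < β) :
    let q₁ : ℝ := (1 + q) / (3 - q)
    let βs : ℝ := (3 - q) / (8 * β ^ (2 - q) * Cq q ^ (2 * (q - 1)))
    let B : ℝ := (2 - q) / (4 * β ^ (2 - q) * Cq q ^ (2 * (q - 1)))
    let V : ℝ → ℝ := fun t => qExpR q₁ (-βs * ξ ^ 2 * t ^ (2 * (2 - q) / (3 - q)))
    (∀ t : ℝ, 0 < t → 0 < V t) ∧
    (∀ t : ℝ, 0 < t →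
      HasDerivAt V (-B * ξ ^ 2 * t ^ (-(q - 1) / (3 - q)) * V t ^ q₁) t) ∧
    (q < 2 → Filter.Tendsto V (nhdsWithin 0 (Set.Ioi 0)) (nhds 1)) := by
  intro q₁ βs B V
  have h3 : 0 < 3 - q := sub_pos.mpr hq3
  have hq₁ : 1 < q₁ := by
    rw [lt_div_iff₀ h3]
    linarith
  have hβs : 0 ≤ βs := by
    have := Real.rpow_nonneg (Cq_nonneg q) (2 * (q - 1))
    positivity
  have hsupp : ∀ t : ℝ, 0 < t →
      0 < 1 + (1 - q₁) * (-βs * ξ ^ 2 * t ^ (2 * (2 - q) / (3 - q))) := by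
    intro t ht
    have h₁ : 0 ≤ βs * ξ ^ 2 * t ^ (2 * (2 - q) / (3 - q)) := by positivity
    nlinarith [mul_nonneg (sub_pos.mpr hq₁).le h₁]
  refine ⟨fun t ht => qExpR_pos hq₁.ne' (hsupp t ht), fun t ht => ?_, fun hq2 => ?_⟩
  · have hpow := (Real.hasDerivAt_rpow_const (p := 2 * (2 - q) / (3 - q))
      (Or.inl ht.ne')).const_mul (-βs * ξ ^ 2)
    have hexp : 2 * (2 - q) / (3 - q) - 1 = -(q - 1) / (3 - q) := by
      field_simp
      ring
    have hB : βs * (2 * (2 - q) / (3 - q)) = B := by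
      simp only [βs, B]
      rw [div_mul_div_comm, mul_comm (_ * _ * _) (3 - q), mul_div_mul_left _ _ h3.ne',
        mul_assoc 8, mul_assoc 4, show (8 : ℝ) = 2 * 4 by norm_num, mul_assoc 2,
        mul_div_mul_left _ _ two_ne_zero]
    rw [hexp] at hpow
    refine ((hasDerivAt_qExpR hq₁.ne' (hsupp t ht)).comp t hpow).congr_deriv ?_
    rw [← hB]
    ring
  · have ha : 0 < 2 * (2 - q) / (3 - q) := div_pos (by linarith) h3
    have hinner : ContinuousAt
        (fun t : ℝ => -βs * ξ ^ 2 * t ^ (2 * (2 - q) / (3 - q))) 0 :=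
      (Real.continuousAt_rpow_const 0 _ (Or.inr ha.le)).const_mul _
    have hzero : -βs * ξ ^ 2 * (0 : ℝ) ^ (2 * (2 - q) / (3 - q)) = 0 := by
      rw [Real.zero_rpow ha.ne', mul_zero]
    have hV : ContinuousAt V 0 := by
      refine ContinuousAt.comp (g := qExpR q₁) ?_ hinner
      rw [hzero]
      exact (hasDerivAt_qExpR hq₁.ne' (by simp)).continuousAt
    have hV0 : V 0 = 1 := by
      simp only [V]
      rw [hzero, qExpR_zero]
    rw [← hV0]
    exact hV.tendsto.mono_left nhdsWithin_le_nhds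

end
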